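/- In dimension four, the Born–Jordan and Weyl quantizations of the squared angular momentum l² = Σ_{1≤i<j≤4} l_{ij}² differ by ℏ² times the identity: as operators on 𝒮(ℝ⁴, ℂ), Σ_{1≤i<j≤4} [ − (2/3) x̂_ip̂_ix̂_jp̂_j − (1/3) x̂_ip̂_ip̂_jx̂_j − (1/3) p̂_ix̂_ix̂_jp̂_j − (2/3) p̂_ix̂_ip̂_jx̂_j + 2 · ((x̂_ip̂_i + p̂_ix̂_i)/2) · ((x̂_jp̂_j + p̂_jx̂_j)/2) ] = ℏ²·id. -/

import Mathlib

open SchwartzMap Finset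

set_option synthInstance.maxHeartbeats 1000000

/-- The difference between the Born–Jordan and Weyl quantizations of `l_{ij}²`
in one conjugate pair of indices in dimension four (the common terms
`x̂_i²p̂_j² + x̂_j²p̂_i²` having cancelled). -/
noncomputable def bjSubWeylTermL2Four
    (X P : Fin 4 → (𝓢(EuclideanSpace ℝ (Fin 4), ℂ) →L[ℂ] 𝓢(EuclideanSpace ℝ (Fin 4), ℂ)))
    (i j : Fin 4) : 𝓢(EuclideanSpace ℝ (Fin 4), ℂ) →L[ℂ] 𝓢(EuclideanSpace ℝ (Fin 4), ℂ) :=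
  -((2 / 3 : ℂ) • (X i * P i * X j * P j)) - (1 / 3 : ℂ) • (X i * P i * P j * X j) -
    (1 / 3 : ℂ) • (P i * X i * X j * P j) - (2 / 3 : ℂ) • (P i * X i * P j * X j) +
    (2 : ℂ) • (((1 / 2 : ℂ) • (X i * P i + P i * X i)) *
      ((1 / 2 : ℂ) • (X j * P j + P j * X j)))

/-- If `x p - p x = c` and `y q - q y = c` for a scalar `c`, then the difference between the
Born–Jordan and Weyl orderings of `-2 (x p) (y q)` is the scalar `-c² / 6`. -/
theorem bornJordan_sub_weyl_of_commutator {R : Type*} [Ring R] [Algebra ℂ R] {x p y q : R} {c : ℂ}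
    (hxp : x * p - p * x = c • (1 : R)) (hyq : y * q - q * y = c • (1 : R)) :
    -((2 / 3 : ℂ) • (x * p * y * q)) - (1 / 3 : ℂ) • (x * p * q * y) -
      (1 / 3 : ℂ) • (p * x * y * q) - (2 / 3 : ℂ) • (p * x * q * y) +
      (2 : ℂ) • (((1 / 2 : ℂ) • (x * p + p * x)) * ((1 / 2 : ℂ) • (y * q + q * y))) =
    (-c ^ 2 / 6) • (1 : R) := by
  have hpx : p * x = x * p - c • (1 : R) := by rw [← hxp]; abel
  have hqy : q * y = y * q - c • (1 : R) := by rw [← hyq]; abel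
  rw [mul_assoc (x * p) y q, mul_assoc (x * p) q y, mul_assoc (p * x) y q,
    mul_assoc (p * x) q y, hpx, hqy]
  generalize x * p = a
  generalize y * q = b
  simp only [mul_sub, sub_mul, mul_add, add_mul, smul_mul_assoc, mul_smul_comm, mul_one, one_mul,
    smul_sub, smul_add]
  module

/-- The canonical commutation relation `[x̂_j, p̂_j] = iℏ` on Schwartz space. -/
theorem position_momentum_commutator {ι : Type*} [Fintype ι] [DecidableEq ι] (ℏ : ℝ) (j : ι)
    (X P : 𝓢(EuclideanSpace ℝ ι, ℂ) →L[ℂ] 𝓢(EuclideanSpace ℝ ι, ℂ))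
    (hX : ∀ (f : 𝓢(EuclideanSpace ℝ ι, ℂ)) (x : EuclideanSpace ℝ ι), X f x = x j * f x)
    (hP : ∀ (f : 𝓢(EuclideanSpace ℝ ι, ℂ)) (x : EuclideanSpace ℝ ι),
      P f x = -(Complex.I * ℏ) * fderiv ℝ (⇑f) x (EuclideanSpace.single j 1)) :
    X * P - P * X =
      (Complex.I * ℏ) • (1 : 𝓢(EuclideanSpace ℝ ι, ℂ) →L[ℂ] 𝓢(EuclideanSpace ℝ ι, ℂ)) := by
  ext f x
  have hXf : ⇑(X f) = fun y : EuclideanSpace ℝ ι => ((y j : ℝ) : ℂ) * f y := funext (hX f)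
  have hcoord : HasFDerivAt (fun y : EuclideanSpace ℝ ι => ((y j : ℝ) : ℂ))
      (Complex.ofRealCLM.comp (EuclideanSpace.proj j : EuclideanSpace ℝ ι →L[ℝ] ℝ)) x :=
    (Complex.ofRealCLM.comp (EuclideanSpace.proj j : EuclideanSpace ℝ ι →L[ℝ] ℝ)).hasFDerivAt
  have hderiv : fderiv ℝ (⇑(X f)) x (EuclideanSpace.single j 1) =
      x j * fderiv ℝ (⇑f) x (EuclideanSpace.single j 1) + f x := by
    have hmul := (hcoord.mul f.differentiableAt.hasFDerivAt).fderiv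
    rw [Pi.mul_def] at hmul
    rw [hXf, hmul]
    simp
  change X (P f) x - P (X f) x = (Complex.I * ℏ) * f x
  rw [hX, hP, hP, hderiv]
  ring

/-- In dimension four, the Born–Jordan and Weyl quantizations of the squared
angular momentum `l² = Σ_{i<j} l_{ij}²` differ by `ℏ²` times the identity. -/
theorem born_jordan_sub_weyl_angular_momentum_squared_dim4 (ℏ : ℝ) (hℏ : 0 < ℏ)
    (X P : Fin 4 → (𝓢(EuclideanSpace ℝ (Fin 4), ℂ) →L[ℂ] 𝓢(EuclideanSpace ℝ (Fin 4), ℂ)))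
    (hX : ∀ (j : Fin 4) (f : 𝓢(EuclideanSpace ℝ (Fin 4), ℂ)) (x : EuclideanSpace ℝ (Fin 4)),
      X j f x = x j * f x)
    (hP : ∀ (j : Fin 4) (f : 𝓢(EuclideanSpace ℝ (Fin 4), ℂ)) (x : EuclideanSpace ℝ (Fin 4)),
      P j f x = -(Complex.I * ℏ) * fderiv ℝ (⇑f) x (EuclideanSpace.single j 1)) :
    (∑ q ∈ univ.filter (fun q : Fin 4 × Fin 4 => q.1 < q.2), bjSubWeylTermL2Four X P q.1 q.2) =
      ((ℏ : ℂ) ^ 2) •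
        (1 : 𝓢(EuclideanSpace ℝ (Fin 4), ℂ) →L[ℂ] 𝓢(EuclideanSpace ℝ (Fin 4), ℂ)) := by
  have hterm : ∀ i j, bjSubWeylTermL2Four X P i j = (-(Complex.I * ℏ) ^ 2 / 6) •
      (1 : 𝓢(EuclideanSpace ℝ (Fin 4), ℂ) →L[ℂ] 𝓢(EuclideanSpace ℝ (Fin 4), ℂ)) := fun i j =>
    bornJordan_sub_weyl_of_commutator
      (position_momentum_commutator ℏ i (X i) (P i) (hX i) (hP i))
      (position_momentum_commutator ℏ j (X j) (P j) (hX j) (hP j))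
  have hcard : (univ.filter (fun q : Fin 4 × Fin 4 => q.1 < q.2)).card = 6 := by decide
  rw [sum_congr rfl fun q _ => hterm q.1 q.2, sum_const, hcard, ← Nat.cast_smul_eq_nsmul ℂ,
    smul_smul]
  congr 1
  rw [mul_pow, Complex.I_sq]
  push_cast
  ring
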